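/- arXiv:1211.2145 — 3 statements merged into one kernel-verified Lean document; each statement's English description precedes it below -/
import Mathlib

section
/- Let h : ℝⁿ → ℝ be smooth with Hessian uniformly bounded below: there is c > 0 such that ⟨H(Y)v, v⟩ ≥ c‖v‖² for all Y, v ∈ ℝⁿ, where H(Y) is the Hessian matrix of h at Y and u = ∇h the gradient. Fix ℏ > 0 and m ∈ ℝⁿ, and define for τ₂ > 0 the integral a(τ₂)² = (τ₂/(πℏ))^{n/2} ∫_{ℝⁿ} e^{−(2τ₂/ℏ)(⟨Y + ℏm, u(Y)⟩ − h(Y))} √(det H(Y)) dY. Assume this integral is finite for some τ₂ = τ₀ > 0. Then it is finite for every τ₂ ≥ τ₀, and lim_{τ₂ → ∞} a(τ₂)² · e^{−(2τ₂/ℏ) h(−ℏm)} = 1. -/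
open MeasureTheory Filter
open scoped RealInnerProductSpace

section Laplace

variable {E : Type*} [NormedAddCommGroup E] [InnerProductSpace ℝ E] [FiniteDimensional ℝ E]
  [MeasurableSpace E] [BorelSpace E]

/-- The Gaussian integral of a positive definite symmetric operator. -/
theorem integral_exp_neg_half_inner_mul_sqrt_det (A : E →ₗ[ℝ] E) (hA : A.IsSymmetric)
    {c : ℝ} (hc : 0 < c) (hpos : ∀ v, c * ‖v‖ ^ 2 ≤ ⟪A v, v⟫) :
    (∫ v : E, Real.exp (-(⟪A v, v⟫ / 2))) * Real.sqrt (LinearMap.det A) =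
      (2 * Real.pi) ^ ((Module.finrank ℝ E : ℝ) / 2) := by
  set b := hA.eigenvectorBasis rfl
  set μ := hA.eigenvalues rfl
  have hμ : ∀ i, 0 < μ i := by
    intro i
    have := hpos (b i)
    rw [hA.apply_eigenvectorBasis] at this
    simp only [RCLike.ofReal_real_eq_id, id_eq, real_inner_smul_left] at this
    change c * ‖b i‖ ^ 2 ≤ μ i * ⟪b i, b i⟫ at this
    rw [real_inner_self_eq_norm_sq, b.orthonormal.1 i] at this
    linarith
  have hquad : ∀ x : Fin (Module.finrank ℝ E) → ℝ,
      ⟪A (b.repr.symm (WithLp.toLp 2 x)), b.repr.symm (WithLp.toLp 2 x)⟫ =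
        ∑ i, μ i * x i ^ 2 := by
    intro x
    rw [← b.repr.inner_map_map, PiLp.inner_apply]
    refine Finset.sum_congr rfl fun i _ => ?_
    rw [hA.eigenvectorBasis_apply_self_apply]
    change inner ℝ (μ i * b.repr (b.repr.symm (WithLp.toLp 2 x)) i) _ = _
    simp
    ring
  have hmp := b.measurePreserving_repr_symm.comp
    (PiLp.volume_preserving_toLp (Fin (Module.finrank ℝ E)))
  have hemb : MeasurableEmbedding
      (b.repr.symm ∘ (WithLp.toLp 2 : (Fin (Module.finrank ℝ E) → ℝ) → _)) :=
    b.repr.symm.toHomeomorph.measurableEmbedding.comp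
      (MeasurableEquiv.toLp 2 (Fin (Module.finrank ℝ E) → ℝ)).measurableEmbedding
  rw [← hmp.integral_comp hemb]
  simp only [Function.comp_apply, hquad]
  have hprod : ∀ x : Fin (Module.finrank ℝ E) → ℝ,
      Real.exp (-((∑ i, μ i * x i ^ 2) / 2)) = ∏ i, Real.exp (-(μ i / 2) * x i ^ 2) := by
    intro x
    rw [← Real.exp_sum, Finset.sum_div, ← Finset.sum_neg_distrib]
    congr 1
    exact Finset.sum_congr rfl fun i _ => by ring
  simp only [hprod]
  rw [integral_fintype_prod_volume_eq_prod (𝕜 := ℝ)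
    (fun i (y : ℝ) => Real.exp (-(μ i / 2) * y ^ 2))]
  simp only [integral_gaussian]
  rw [hA.det_eq_prod_eigenvalues rfl]
  change _ * Real.sqrt (∏ i, μ i) = _
  rw [Real.sqrt_eq_rpow, ← Real.finsetProd_rpow _ _ fun i _ => (hμ i).le,
    ← Finset.prod_mul_distrib]
  have : ∀ i, Real.sqrt (Real.pi / (μ i / 2)) * μ i ^ (1 / 2 : ℝ) = (2 * Real.pi) ^ (1 / 2 : ℝ) := by
    intro i
    have := hμ i
    rw [Real.sqrt_eq_rpow, ← Real.mul_rpow (by positivity) this.le]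
    congr 1
    field_simp
  simp only [this, Finset.prod_const, Finset.card_univ, Fintype.card_fin]
  rw [← Real.rpow_natCast, ← Real.rpow_mul (by positivity)]
  congr 1
  ring

theorem integrable_exp_neg_mul_of_le {f D : E → ℝ} (hf : Continuous f) (hD : Continuous D)
    (hf0 : ∀ Y, 0 ≤ f Y) {s₀ s : ℝ} (hs : s₀ ≤ s)
    (hint : Integrable fun Y => Real.exp (-s₀ * f Y) * D Y) :
    Integrable fun Y => Real.exp (-s * f Y) * D Y := by
  refine hint.mono (by fun_prop) (Eventually.of_forall fun Y => ?_)
  rw [norm_mul, norm_mul, Real.norm_of_nonneg (Real.exp_pos _).le,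
    Real.norm_of_nonneg (Real.exp_pos _).le]
  refine mul_le_mul_of_nonneg_right (Real.exp_le_exp.2 ?_) (norm_nonneg _)
  nlinarith [hf0 Y]

/-- The part of a Laplace integral away from the minimum is negligible. -/
theorem tendsto_rpow_mul_setIntegral_compl_ball {f D : E → ℝ} (hf : Continuous f)
    (hD : Continuous D) (hD0 : ∀ Y, 0 ≤ D Y) {x₀ : E} {c : ℝ} (hc : 0 < c)
    (hlow : ∀ Y, c * ‖Y - x₀‖ ^ 2 ≤ f Y) {s₀ : ℝ}
    (hint : Integrable fun Y => Real.exp (-s₀ * f Y) * D Y) (p : ℝ) :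
    Tendsto (fun s : ℝ => s ^ p *
      ∫ Y in (Metric.ball x₀ 1)ᶜ, Real.exp (-s * f Y) * D Y) atTop (nhds 0) := by
  have hf0 : ∀ Y, 0 ≤ f Y := fun Y => le_trans (by positivity) (hlow Y)
  have hbd := ((tendsto_rpow_mul_exp_neg_mul_atTop_nhds_zero p c hc).mul_const
    (Real.exp (s₀ * c) * ∫ Y, Real.exp (-s₀ * f Y) * D Y))
  rw [zero_mul] at hbd
  refine squeeze_zero' ?_ ?_ hbd
  · filter_upwards [eventually_ge_atTop 0] with s hs
    exact mul_nonneg (Real.rpow_nonneg hs _)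
      (integral_nonneg fun Y => mul_nonneg (Real.exp_pos _).le (hD0 Y))
  · filter_upwards [eventually_ge_atTop 0, eventually_ge_atTop s₀] with s hs hs₀
    rw [mul_assoc]
    refine mul_le_mul_of_nonneg_left ?_ (Real.rpow_nonneg hs _)
    rw [← mul_assoc, ← Real.exp_add, ← integral_const_mul]
    refine (setIntegral_mono_on
      (integrable_exp_neg_mul_of_le hf hD hf0 hs₀ hint).integrableOn
      (hint.const_mul _).integrableOn measurableSet_ball.compl fun Y hY => ?_).trans
      (setIntegral_le_integral (hint.const_mul _) (Eventually.of_forall fun Y =>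
        mul_nonneg (Real.exp_pos _).le (mul_nonneg (Real.exp_pos _).le (hD0 Y))))
    rw [← mul_assoc, ← Real.exp_add]
    refine mul_le_mul_of_nonneg_right (Real.exp_le_exp.2 ?_) (hD0 Y)
    have h1 : 1 ≤ ‖Y - x₀‖ := by simpa [dist_eq_norm] using hY
    have h2 : c ≤ f Y := (le_mul_of_one_le_right hc.le (one_le_pow₀ h1)).trans (hlow Y)
    nlinarith

theorem rpow_finrank_div_two_mul_integral (G : E → ℝ) (x₀ : E) {s : ℝ} (hs : 0 < s) :
    s ^ ((Module.finrank ℝ E : ℝ) / 2) * ∫ Y, G Y = ∫ v, G (x₀ + (Real.sqrt s)⁻¹ • v) := by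
  rw [Measure.integral_comp_smul volume (fun v => G (x₀ + v)), integral_add_left_eq_self G x₀,
    smul_eq_mul, abs_of_nonneg (by positivity), inv_pow, inv_inv, Real.sqrt_eq_rpow,
    ← Real.rpow_natCast, ← Real.rpow_mul hs.le]
  congr 2
  ring

/-- The part of a Laplace integral close to the minimum is asymptotically Gaussian. -/
theorem tendsto_rpow_mul_setIntegral_ball {f D : E → ℝ} (hf : Continuous f)
    (hD : Continuous D) {x₀ : E} {c : ℝ} (hc : 0 < c)
    (hlow : ∀ Y, c * ‖Y - x₀‖ ^ 2 ≤ f Y) {Q : E → ℝ}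
    (hQ : ∀ v, Tendsto (fun t : ℝ => f (x₀ + t • v) / t ^ 2) (nhdsWithin 0 (Set.Ioi 0))
      (nhds (Q v))) :
    Tendsto (fun s : ℝ => s ^ ((Module.finrank ℝ E : ℝ) / 2) *
      ∫ Y in Metric.ball x₀ 1, Real.exp (-s * f Y) * D Y) atTop
      (nhds ((∫ v, Real.exp (-Q v)) * D x₀)) := by
  have hr : Tendsto (fun s : ℝ => (Real.sqrt s)⁻¹) atTop (nhdsWithin 0 (Set.Ioi 0)) :=
    tendsto_inv_atTop_nhdsGT_zero.comp Real.tendsto_sqrt_atTop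
  obtain ⟨M, hM⟩ := (isCompact_closedBall x₀ 1).exists_bound_of_continuousOn hD.continuousOn
  have hM0 : 0 ≤ M := (norm_nonneg _).trans (hM x₀ (by simp))
  have hgauss : Integrable fun v : E => Real.exp (-c * ‖v‖ ^ 2) := by
    by_contra hcon
    have h1 := GaussianFourier.integral_rexp_neg_mul_sq_norm (V := E) hc
    rw [integral_undef hcon] at h1
    exact absurd h1 (by positivity)
  have key : Tendsto (fun s : ℝ => ∫ v : E, (Metric.ball x₀ 1).indicator
      (fun Y => Real.exp (-s * f Y) * D Y) (x₀ + (Real.sqrt s)⁻¹ • v)) atTop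
      (nhds (∫ v, Real.exp (-Q v) * D x₀)) := by
    refine tendsto_integral_filter_of_dominated_convergence
      (fun v => Real.exp (-c * ‖v‖ ^ 2) * M) ?_ ?_ (hgauss.mul_const M) ?_
    · refine Eventually.of_forall fun s => Measurable.aestronglyMeasurable ?_
      exact ((by fun_prop : Continuous fun Y => Real.exp (-s * f Y) * D Y).measurable.indicator
        measurableSet_ball).comp (by fun_prop)
    · filter_upwards [eventually_gt_atTop 0] with s hs
      refine Eventually.of_forall fun v => ?_
      by_cases hv : x₀ + (Real.sqrt s)⁻¹ • v ∈ Metric.ball x₀ 1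
      · rw [Set.indicator_of_mem hv, norm_mul, Real.norm_eq_abs, Real.abs_exp]
        refine mul_le_mul (Real.exp_le_exp.2 ?_) ?_ (norm_nonneg _) (Real.exp_pos _).le
        · have h1 := hlow (x₀ + (Real.sqrt s)⁻¹ • v)
          rw [add_sub_cancel_left, norm_smul, mul_pow, Real.norm_eq_abs, sq_abs, inv_pow,
            Real.sq_sqrt hs.le] at h1
          have h2 := mul_le_mul_of_nonneg_left h1 hs.le
          have h3 : s * (c * (s⁻¹ * ‖v‖ ^ 2)) = c * ‖v‖ ^ 2 := by field_simp
          linarith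
        · exact hM _ (Metric.ball_subset_closedBall hv)
      · rw [Set.indicator_of_notMem hv, norm_zero]
        positivity
    · refine Eventually.of_forall fun v => ?_
      have hx : Tendsto (fun s : ℝ => x₀ + (Real.sqrt s)⁻¹ • v) atTop (nhds x₀) := by
        have h1 := ((hr.mono_right nhdsWithin_le_nhds).smul_const v).const_add x₀
        rwa [zero_smul, add_zero] at h1
      have h2 : Tendsto (fun s : ℝ => Real.exp (-s * f (x₀ + (Real.sqrt s)⁻¹ • v)) *
          D (x₀ + (Real.sqrt s)⁻¹ • v)) atTop (nhds (Real.exp (-Q v) * D x₀)) := by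
        refine Tendsto.mul ((Real.continuous_exp.tendsto _).comp ?_) ((hD.tendsto _).comp hx)
        refine ((hQ v).comp hr).neg.congr' ?_
        filter_upwards [eventually_gt_atTop 0] with s hs
        simp only [Function.comp_apply]
        rw [inv_pow, Real.sq_sqrt hs.le, div_inv_eq_mul]
        ring
      refine h2.congr' ?_
      filter_upwards [hx (Metric.ball_mem_nhds x₀ one_pos)] with s hs
      exact (Set.indicator_of_mem (s := Metric.ball x₀ 1) hs
        fun Y => Real.exp (-s * f Y) * D Y).symm
  rw [integral_mul_const] at key
  refine key.congr' ?_
  filter_upwards [eventually_gt_atTop 0] with s hs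
  rw [← rpow_finrank_div_two_mul_integral _ x₀ hs, integral_indicator measurableSet_ball]

/-- Laplace's method for a phase with a nondegenerate global minimum at `x₀`. -/
theorem tendsto_rpow_mul_integral_exp_neg_mul {f D : E → ℝ} (hf : Continuous f)
    (hD : Continuous D) (hD0 : ∀ Y, 0 ≤ D Y) {x₀ : E} {c : ℝ} (hc : 0 < c)
    (hlow : ∀ Y, c * ‖Y - x₀‖ ^ 2 ≤ f Y) {Q : E → ℝ}
    (hQ : ∀ v, Tendsto (fun t : ℝ => f (x₀ + t • v) / t ^ 2) (nhdsWithin 0 (Set.Ioi 0))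
      (nhds (Q v))) {s₀ : ℝ} (hint : Integrable fun Y => Real.exp (-s₀ * f Y) * D Y) :
    Tendsto (fun s : ℝ => s ^ ((Module.finrank ℝ E : ℝ) / 2) *
      ∫ Y, Real.exp (-s * f Y) * D Y) atTop (nhds ((∫ v, Real.exp (-Q v)) * D x₀)) := by
  have h := (tendsto_rpow_mul_setIntegral_ball hf hD hc hlow hQ).add
    (tendsto_rpow_mul_setIntegral_compl_ball hf hD hD0 hc hlow hint
      ((Module.finrank ℝ E : ℝ) / 2))
  rw [add_zero] at h
  refine h.congr' ?_
  filter_upwards [eventually_ge_atTop s₀] with s hs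
  rw [← mul_add, integral_add_compl measurableSet_ball
    (integrable_exp_neg_mul_of_le hf hD (fun Y => le_trans (by positivity) (hlow Y)) hs hint)]

end Laplace

section LegendreGap

variable {E : Type*} [NormedAddCommGroup E] [NormedSpace ℝ E]

/-- Along rays from `x₀`, the function `Y ↦ h'(Y)(Y - x₀) - h(Y) + h(x₀)` has derivative
`t * h''(v, v)`. -/
theorem hasDerivAt_fderiv_sub_self_ray {h : E → ℝ} (hsm : ContDiff ℝ 2 h) (x₀ v : E) (t : ℝ) :
    HasDerivAt (fun t : ℝ => fderiv ℝ h (x₀ + t • v) (t • v) - h (x₀ + t • v) + h x₀)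
      (t * fderiv ℝ (fderiv ℝ h) (x₀ + t • v) v v) t := by
  have hray : HasDerivAt (fun t : ℝ => x₀ + t • v) v t := by
    simpa using ((hasDerivAt_id t).smul_const v).const_add x₀
  have h1 : HasDerivAt (fun t : ℝ => h (x₀ + t • v)) (fderiv ℝ h (x₀ + t • v) v) t :=
    ((hsm.differentiable (by norm_num)) _).hasFDerivAt.comp_hasDerivAt t hray
  have h2 : HasDerivAt (fun t : ℝ => fderiv ℝ h (x₀ + t • v))
      (fderiv ℝ (fderiv ℝ h) (x₀ + t • v) v) t :=
    (((hsm.fderiv_right (m := 1) (by norm_num)).differentiable (by norm_num)) _).hasFDerivAt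
      |>.comp_hasDerivAt t hray
  have h3 := ((hasDerivAt_id t).mul (h2.clm_apply (hasDerivAt_const t v))).sub h1 |>.add_const (h x₀)
  simpa using h3

theorem le_fderiv_sub_self {h : E → ℝ} (hsm : ContDiff ℝ 2 h) {c : ℝ}
    (hbd : ∀ Y v : E, c * ‖v‖ ^ 2 ≤ fderiv ℝ (fderiv ℝ h) Y v v) (x₀ Y : E) :
    c / 2 * ‖Y - x₀‖ ^ 2 ≤ fderiv ℝ h Y (Y - x₀) - h Y + h x₀ := by
  set v := Y - x₀ with hv
  have hder : ∀ t : ℝ, HasDerivAt (fun t : ℝ =>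
      (fderiv ℝ h (x₀ + t • v) (t • v) - h (x₀ + t • v) + h x₀) - c / 2 * ‖v‖ ^ 2 * t ^ 2)
      (t * fderiv ℝ (fderiv ℝ h) (x₀ + t • v) v v - c / 2 * ‖v‖ ^ 2 * (2 * t)) t := by
    intro t
    refine (hasDerivAt_fderiv_sub_self_ray hsm x₀ v t).sub ?_
    simpa using (hasDerivAt_pow 2 t).const_mul (c / 2 * ‖v‖ ^ 2)
  have hmono := monotoneOn_of_deriv_nonneg (convex_Icc (0 : ℝ) 1)
    (fun t _ => (hder t).continuousAt.continuousWithinAt)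
    (fun t _ => (hder t).differentiableAt.differentiableWithinAt) (by
      intro t ht
      rw [interior_Icc] at ht
      rw [(hder t).deriv]
      nlinarith [hbd (x₀ + t • v) v, ht.1])
  have := hmono (by simp) (by simp) (zero_le_one' ℝ)
  simp only [zero_smul, one_smul, add_zero, map_zero, zero_sub, neg_add_cancel] at this
  rw [show x₀ + v = Y by simp [hv]] at this
  linarith

theorem tendsto_fderiv_sub_self_ray_div_sq {h : E → ℝ} (hsm : ContDiff ℝ 2 h) (x₀ v : E) :
    Tendsto (fun t : ℝ =>
      (fderiv ℝ h (x₀ + t • v) (t • v) - h (x₀ + t • v) + h x₀) / t ^ 2)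
      (nhdsWithin 0 (Set.Ioi 0)) (nhds (fderiv ℝ (fderiv ℝ h) x₀ v v / 2)) := by
  refine HasDerivAt.lhopital_zero_nhdsGT (g' := fun t => 2 * t)
    (Eventually.of_forall (hasDerivAt_fderiv_sub_self_ray hsm x₀ v))
    (Eventually.of_forall fun t => by simpa using hasDerivAt_pow 2 t) ?_ ?_ ?_ ?_
  · filter_upwards [self_mem_nhdsWithin] with t ht
    exact mul_ne_zero two_ne_zero (ne_of_gt ht)
  · have := (hasDerivAt_fderiv_sub_self_ray hsm x₀ v 0).continuousAt.tendsto
    simp only [zero_smul, add_zero, map_zero, zero_sub, neg_add_cancel] at this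
    exact this.mono_left nhdsWithin_le_nhds
  · have : Tendsto (fun t : ℝ => t ^ 2) (nhds 0) (nhds (0 ^ 2)) := (continuous_pow 2).tendsto 0
    rw [zero_pow two_ne_zero] at this
    exact this.mono_left nhdsWithin_le_nhds
  · have hcont : Continuous fun t : ℝ => fderiv ℝ (fderiv ℝ h) (x₀ + t • v) v v / 2 := by
      have h2 : Continuous (fderiv ℝ (fderiv ℝ h)) :=
        (hsm.fderiv_right (m := 1) (by norm_num)).continuous_fderiv (by norm_num)
      fun_prop
    have := hcont.tendsto 0
    simp only [zero_smul, add_zero] at this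
    refine (this.mono_left nhdsWithin_le_nhds).congr' ?_
    filter_upwards [self_mem_nhdsWithin] with t ht
    have : t ≠ 0 := ne_of_gt ht
    field_simp

end LegendreGap

/-- Large imaginary time (`τ₂ → ∞`) asymptotic unitarity of the KSH map in the abelian
case `K = Tⁿ`: the squared norm
`a(τ₂)² = (τ₂/(πℏ))^{n/2} ∫ e^{−(2τ₂/ℏ)(⟪Y+ℏm, ∇h(Y)⟫−h(Y))} √(det H(Y)) dY`
satisfies `a(τ₂)² e^{−(2τ₂/ℏ)h(−ℏm)} → 1` as `τ₂ → ∞` (and the integral is finite for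
all `τ₂ ≥ τ₀` once it is finite for `τ₀`). -/
theorem ksh_asymptotic_unitarity_large_imaginary_time
    (n : ℕ) (h : EuclideanSpace ℝ (Fin n) → ℝ) (hsm : ContDiff ℝ (⊤ : ℕ∞) h)
    (H : EuclideanSpace ℝ (Fin n) → EuclideanSpace ℝ (Fin n) →L[ℝ] EuclideanSpace ℝ (Fin n))
    (hH : ∀ Y v w : EuclideanSpace ℝ (Fin n), ⟪H Y v, w⟫ = fderiv ℝ (fderiv ℝ h) Y v w)
    (c : ℝ) (hc : 0 < c)
    (hbd : ∀ Y v : EuclideanSpace ℝ (Fin n), c * ‖v‖ ^ 2 ≤ ⟪H Y v, v⟫)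
    (ℏ : ℝ) (hℏ : 0 < ℏ) (m : EuclideanSpace ℝ (Fin n))
    (τ₀ : ℝ) (hτ₀ : 0 < τ₀)
    (hint : Integrable (fun Y : EuclideanSpace ℝ (Fin n) =>
      Real.exp (-(2 * τ₀ / ℏ) * (⟪Y + ℏ • m, gradient h Y⟫ - h Y)) *
        Real.sqrt (LinearMap.det (H Y : EuclideanSpace ℝ (Fin n) →ₗ[ℝ] EuclideanSpace ℝ (Fin n))))) :
    (∀ τ₂ : ℝ, τ₀ ≤ τ₂ → Integrable (fun Y : EuclideanSpace ℝ (Fin n) =>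
      Real.exp (-(2 * τ₂ / ℏ) * (⟪Y + ℏ • m, gradient h Y⟫ - h Y)) *
        Real.sqrt (LinearMap.det (H Y : EuclideanSpace ℝ (Fin n) →ₗ[ℝ] EuclideanSpace ℝ (Fin n))))) ∧
    Tendsto (fun τ₂ : ℝ =>
        (τ₂ / (Real.pi * ℏ)) ^ ((n : ℝ) / 2) *
          (∫ Y : EuclideanSpace ℝ (Fin n),
            Real.exp (-(2 * τ₂ / ℏ) * (⟪Y + ℏ • m, gradient h Y⟫ - h Y)) *
              Real.sqrt (LinearMap.det (H Y : EuclideanSpace ℝ (Fin n) →ₗ[ℝ] EuclideanSpace ℝ (Fin n)))) *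
          Real.exp (-(2 * τ₂ / ℏ) * h (-(ℏ • m))))
      atTop (nhds 1) := by
  have hsm2 : ContDiff ℝ 2 h := hsm.of_le (WithTop.coe_le_coe.2 le_top)
  have hcont2 : Continuous (fderiv ℝ (fderiv ℝ h)) :=
    (hsm2.fderiv_right (m := 1) (by norm_num)).continuous_fderiv (by norm_num)
  have hHcont : Continuous H := by
    have hHeq : H = fun Y => ((InnerProductSpace.toDual ℝ
        (EuclideanSpace ℝ (Fin n))).symm.toContinuousLinearEquiv.toContinuousLinearMap).comp
          (fderiv ℝ (fderiv ℝ h) Y) := by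
      funext Y
      ext1 v
      refine ext_inner_right ℝ fun w => ?_
      rw [hH]
      exact InnerProductSpace.toDual_symm_apply.symm
    rw [hHeq]
    exact continuous_const.clm_comp hcont2
  set x₀ : EuclideanSpace ℝ (Fin n) := -(ℏ • m) with hx₀
  set D : EuclideanSpace ℝ (Fin n) → ℝ := fun Y => Real.sqrt
    (LinearMap.det (H Y : EuclideanSpace ℝ (Fin n) →ₗ[ℝ] EuclideanSpace ℝ (Fin n)))
  set f : EuclideanSpace ℝ (Fin n) → ℝ := fun Y => fderiv ℝ h Y (Y - x₀) - h Y + h x₀ with hf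
  have hD : Continuous D :=
    Real.continuous_sqrt.comp (ContinuousLinearMap.continuous_det.comp hHcont)
  have hfc : Continuous f := by
    have h1 : Continuous (fderiv ℝ h) := hsm2.continuous_fderiv (by norm_num)
    have h0 : Continuous h := hsm2.continuous
    fun_prop
  have hlow : ∀ Y, c / 2 * ‖Y - x₀‖ ^ 2 ≤ f Y :=
    fun Y => le_fderiv_sub_self hsm2 (fun Y v => (hbd Y v).trans_eq (hH Y v v)) x₀ Y
  have hQ : ∀ v, Tendsto (fun t : ℝ => f (x₀ + t • v) / t ^ 2) (nhdsWithin 0 (Set.Ioi 0))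
      (nhds (⟪H x₀ v, v⟫ / 2)) := fun v => by
    simpa only [hf, hH, add_sub_cancel_left] using tendsto_fderiv_sub_self_ray_div_sq hsm2 x₀ v
  have hsplit : ∀ τ Y, Real.exp (-(2 * τ / ℏ) * (⟪Y + ℏ • m, gradient h Y⟫ - h Y)) * D Y =
      Real.exp (2 * τ / ℏ * h x₀) * (Real.exp (-(2 * τ / ℏ) * f Y) * D Y) := by
    intro τ Y
    rw [← mul_assoc, ← Real.exp_add, real_inner_comm, inner_gradient_left]
    simp only [hf, hx₀, sub_neg_eq_add]
    congr 2
    ring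
  have hint' : ∀ τ, (Integrable fun Y =>
      Real.exp (-(2 * τ / ℏ) * (⟪Y + ℏ • m, gradient h Y⟫ - h Y)) * D Y) ↔
      Integrable fun Y => Real.exp (-(2 * τ / ℏ) * f Y) * D Y := by
    intro τ
    simp only [hsplit]
    exact integrable_const_mul_iff (isUnit_iff_ne_zero.2 (Real.exp_ne_zero _)) _
  have hint₀ := (hint' τ₀).1 hint
  refine ⟨fun τ hτ => (hint' τ).2 (integrable_exp_neg_mul_of_le hfc hD
    (fun Y => le_trans (by positivity) (hlow Y)) (by gcongr) hint₀), ?_⟩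
  have hsym : (H x₀ : EuclideanSpace ℝ (Fin n) →ₗ[ℝ] EuclideanSpace ℝ (Fin n)).IsSymmetric := by
    intro v w
    change ⟪H x₀ v, w⟫ = ⟪v, H x₀ w⟫
    rw [real_inner_comm (H x₀ w) v, hH, hH]
    exact (hsm2.contDiffAt.isSymmSndFDerivAt (by simp)).eq v w
  have hlim := (tendsto_rpow_mul_integral_exp_neg_mul hfc hD (fun Y => Real.sqrt_nonneg _)
    (half_pos hc) hlow hQ hint₀).comp
      ((tendsto_id.const_mul_atTop two_pos).atTop_div_const hℏ)
  have hgauss := integral_exp_neg_half_inner_mul_sqrt_det _ hsym hc (hbd x₀)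
  change (∫ v, Real.exp (-(⟪H x₀ v, v⟫ / 2))) * D x₀ = _ at hgauss
  rw [hgauss] at hlim
  have hone := hlim.const_mul ((2 * Real.pi) ^ ((n : ℝ) / 2))⁻¹
  rw [finrank_euclideanSpace_fin, inv_mul_cancel₀ (by positivity)] at hone
  refine hone.congr' ?_
  filter_upwards [eventually_gt_atTop 0] with τ hτ
  change _ = _ * (∫ Y, Real.exp (-(2 * τ / ℏ) * (⟪Y + ℏ • m, gradient h Y⟫ - h Y)) * D Y) * _
  simp only [hsplit, integral_const_mul, Function.comp_apply, id_eq]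
  have hscale : (2 * τ / ℏ) ^ ((n : ℝ) / 2) =
      (2 * Real.pi) ^ ((n : ℝ) / 2) * (τ / (Real.pi * ℏ)) ^ ((n : ℝ) / 2) := by
    rw [← Real.mul_rpow (by positivity) (by positivity)]
    congr 1
    field_simp
  have hexp : Real.exp (2 * τ / ℏ * h x₀) * Real.exp (-(2 * τ / ℏ) * h x₀) = 1 := by
    rw [← Real.exp_add]
    simp
  have hpi : ((2 * Real.pi) ^ ((n : ℝ) / 2) : ℝ) ≠ 0 := by positivity
  rw [hscale, ← mul_assoc, ← mul_assoc, inv_mul_cancel₀ hpi, one_mul]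
  linear_combination (-((τ / (Real.pi * ℏ)) ^ ((n : ℝ) / 2) *
    ∫ Y, Real.exp (-(2 * τ / ℏ) * f Y) * D Y)) * hexp
end

section
/- Let h : ℝⁿ → ℝ be smooth with Hessian uniformly bounded below: there is c > 0 such that ⟨H(Y)v, v⟩ ≥ c‖v‖² for all Y, v ∈ ℝⁿ, where H(Y) is the Hessian matrix of h at Y and u = ∇h the gradient. Fix τ₂ > 0, b > 0 and m ∈ ℝⁿ, and define for ℏ > 0 the integral I(ℏ) = (τ₂/(πℏ))^{n/2} ∫_{ℝⁿ} e^{−(2τ₂/ℏ)(⟨Y + b·m, u(Y)⟩ − h(Y))} √(det H(Y)) dY. Assume this integral is finite for some ℏ = ℏ₀ > 0. Then it is finite for every ℏ ∈ (0, ℏ₀], and lim_{ℏ → 0⁺} I(ℏ) · e^{−(2τ₂/ℏ) h(−b·m)} = 1. -/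
open MeasureTheory Filter
open scoped RealInnerProductSpace Topology

section Gaussian

variable {E : Type*} [NormedAddCommGroup E] [InnerProductSpace ℝ E] [FiniteDimensional ℝ E]
  [MeasurableSpace E] [BorelSpace E]

lemma integrable_rexp_neg_mul_sq_norm {k : ℝ} (hk : 0 < k) :
    Integrable (fun X : E => Real.exp (-k * ‖X‖ ^ 2)) := by
  have := (GaussianFourier.integrable_cexp_neg_mul_sq_norm_add (V := E) (b := (k : ℂ))
    (by simpa using hk) 0 0).norm
  refine this.congr (ae_of_all _ fun x => ?_)
  simp [Complex.norm_exp, ← Complex.ofReal_pow]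

lemma integral_rexp_neg_half_inner_eq {T : E →ₗ[ℝ] E} (hT : T.IsSymmetric)
    (hpos : ∀ v, v ≠ 0 → 0 < ⟪T v, v⟫) :
    0 < LinearMap.det T ∧
    ∫ X : E, Real.exp (-(⟪T X, X⟫ / 2)) =
      (2 * Real.pi) ^ ((Module.finrank ℝ E : ℝ) / 2) / √(LinearMap.det T) := by
  set B := hT.eigenvectorBasis rfl with hB
  set μ := hT.eigenvalues rfl with hμ
  have hμpos : ∀ i, 0 < μ i := by
    intro i
    have h1 := hpos (B i) (B.orthonormal.ne_zero i)
    rw [hB, hT.apply_eigenvectorBasis rfl i, ← hB, inner_smul_left] at h1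
    simpa using h1
  have hdet : LinearMap.det T = ∏ i, μ i := by
    simpa using hT.det_eq_prod_eigenvalues rfl
  have hquad : ∀ X, Real.exp (-(⟪T X, X⟫ / 2)) =
      (fun x : EuclideanSpace ℝ (Fin (Module.finrank ℝ E)) =>
        ∏ i, Real.exp (-(μ i / 2) * (x i) ^ 2)) (B.repr X) := by
    intro X
    have h1 : ⟪T X, X⟫ = ∑ i, μ i * (B.repr X i) ^ 2 := by
      rw [← B.repr.inner_map_map (T X) X, PiLp.inner_apply]
      refine Finset.sum_congr rfl fun i _ => ?_
      rw [hB, hT.eigenvectorBasis_apply_self_apply rfl X i]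
      simp [← hμ]
      ring
    simp only [← Real.exp_sum]
    rw [h1, Finset.sum_div, ← Finset.sum_neg_distrib]
    congr 1
    exact Finset.sum_congr rfl fun i _ => by ring
  have hdpos : 0 < ∏ i, μ i := Finset.prod_pos fun i _ => hμpos i
  refine ⟨hdet ▸ hdpos, ?_⟩
  rw [funext hquad]
  refine (B.measurePreserving_repr.integral_comp
    B.repr.toHomeomorph.measurableEmbedding
    (fun x : EuclideanSpace ℝ (Fin (Module.finrank ℝ E)) =>
      ∏ i, Real.exp (-(μ i / 2) * (x i) ^ 2))).trans ?_
  rw [← (PiLp.volume_preserving_toLp (Fin (Module.finrank ℝ E))).integral_comp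
      (MeasurableEquiv.toLp 2 _).measurableEmbedding]
  have h2 := integral_fintype_prod_volume_eq_prod (𝕜 := ℝ) (E := fun _ => ℝ)
    (fun (i : Fin (Module.finrank ℝ E)) (x : ℝ) => Real.exp (-(μ i / 2) * x ^ 2))
  simp only [integral_gaussian] at h2
  refine h2.trans ?_
  have h3 : ∀ i, √(Real.pi / (μ i / 2)) = √(2 * Real.pi) / √(μ i) := by
    intro i
    rw [← Real.sqrt_div (by positivity)]
    congr 1
    have := (hμpos i).ne'
    field_simp
  simp_rw [h3]
  rw [Finset.prod_div_distrib, hdet, Finset.prod_const, Finset.card_univ, Fintype.card_fin,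
    Real.sqrt_eq_rpow, ← Real.rpow_natCast, ← Real.rpow_mul (by positivity)]
  congr 1
  · congr 1
    ring
  · simp only [Real.sqrt_eq_rpow]
    exact Real.finsetProd_rpow _ _ (fun i _ => (hμpos i).le) _

end Gaussian

section Laplace

lemma integrable_rexp_neg_mul_mul_of_le {E : Type*} [TopologicalSpace E] [MeasurableSpace E]
    [OpensMeasurableSpace E] {μ : Measure E} {φ w : E → ℝ} (hφ : Continuous φ)
    (hφ0 : ∀ Z, 0 ≤ φ Z) {r₀ r : ℝ} (hr : r₀ ≤ r)
    (hint : Integrable (fun Z => Real.exp (-r₀ * φ Z) * w Z) μ) :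
    Integrable (fun Z => Real.exp (-r * φ Z) * w Z) μ := by
  have h1 : (fun Z => Real.exp (-r * φ Z) * w Z) =
      fun Z => Real.exp (-(r - r₀) * φ Z) * (Real.exp (-r₀ * φ Z) * w Z) := by
    funext Z
    rw [← mul_assoc, ← Real.exp_add]
    congr 2
    ring
  rw [h1]
  refine hint.bdd_mul (c := 1) (by fun_prop) (ae_of_all _ fun Z => ?_)
  rw [Real.norm_eq_abs, Real.abs_exp, Real.exp_le_one_iff]
  nlinarith [mul_nonneg (sub_nonneg.2 hr) (hφ0 Z)]

lemma tendsto_inv_pow_mul_exp_neg_inv_sq {k : ℝ} (hk : 0 < k) (d : ℕ) :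
    Tendsto (fun s : ℝ => (s ^ d)⁻¹ * Real.exp (-k * (s ^ 2)⁻¹)) (𝓝[>] 0) (𝓝 0) := by
  have h1 : Tendsto (fun x : ℝ => x ^ (d : ℝ) * Real.exp (-k * x ^ 2)) atTop (𝓝 0) := by
    refine (rpow_mul_exp_neg_mul_sq_isLittleO_exp_neg hk d).trans_tendsto ?_
    refine Real.tendsto_exp_atBot.comp ?_
    exact tendsto_id.const_mul_atTop_of_neg (by norm_num)
  refine (h1.comp tendsto_inv_nhdsGT_zero).congr fun s => ?_
  simp

variable {E : Type*} [NormedAddCommGroup E] [InnerProductSpace ℝ E] [FiniteDimensional ℝ E]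
  [MeasurableSpace E] [BorelSpace E]

/-- **Laplace's method** around a global quadratic minimum at the origin. -/
lemma tendsto_laplace_integral {φ w Q : E → ℝ} (hφ : Continuous φ) (hw : Continuous w)
    (hw0 : ∀ Z, 0 ≤ w Z) {k : ℝ} (hk : 0 < k) (hφk : ∀ Z, k * ‖Z‖ ^ 2 ≤ φ Z)
    (hQ : ∀ X, Tendsto (fun t : ℝ => φ (t • X) / t ^ 2) (𝓝[>] 0) (𝓝 (Q X))) {r₀ : ℝ}
    (hint : Integrable (fun Z => Real.exp (-r₀ * φ Z) * w Z)) :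
    Tendsto (fun s : ℝ => (s ^ Module.finrank ℝ E)⁻¹ *
        ∫ Z, Real.exp (-(s ^ 2)⁻¹ * φ Z) * w Z)
      (𝓝[>] 0) (𝓝 (w 0 * ∫ X, Real.exp (-Q X))) := by
  have hφ0 : ∀ Z, 0 ≤ φ Z := fun Z => le_trans (by positivity) (hφk Z)
  set B : Set E := Metric.closedBall 0 1 with hB
  have hBm : MeasurableSet B := Metric.isClosed_closedBall.measurableSet
  obtain ⟨C, hC⟩ := (isCompact_closedBall (0 : E) 1).exists_bound_of_continuousOn hw.continuousOn
  have hpos : ∀ᶠ s : ℝ in 𝓝[>] 0, 0 < s := self_mem_nhdsWithin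
  have hlarge : ∀ᶠ s : ℝ in 𝓝[>] 0, r₀ ≤ (s ^ 2)⁻¹ := by
    have h1 : Tendsto (fun s : ℝ => (s⁻¹) ^ 2) (𝓝[>] 0) atTop :=
      (tendsto_pow_atTop two_ne_zero).comp tendsto_inv_nhdsGT_zero
    filter_upwards [h1.eventually_ge_atTop r₀] with s hs
    simpa using hs
  -- contribution of the unit ball
  have hin : Tendsto (fun s : ℝ => (s ^ Module.finrank ℝ E)⁻¹ *
        ∫ Z in B, Real.exp (-(s ^ 2)⁻¹ * φ Z) * w Z)
      (𝓝[>] 0) (𝓝 (w 0 * ∫ X, Real.exp (-Q X))) := by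
    have hresc : ∀ᶠ s : ℝ in 𝓝[>] 0,
        ∫ X, B.indicator (fun Z => Real.exp (-(s ^ 2)⁻¹ * φ Z) * w Z) (s • X) =
        (s ^ Module.finrank ℝ E)⁻¹ * ∫ Z in B, Real.exp (-(s ^ 2)⁻¹ * φ Z) * w Z := by
      filter_upwards [hpos] with s hs
      rw [Measure.integral_comp_smul, integral_indicator hBm, smul_eq_mul,
        abs_of_pos (by positivity)]
    refine Tendsto.congr' hresc ?_
    rw [← integral_const_mul]
    refine tendsto_integral_filter_of_dominated_convergence
      (fun X => C * Real.exp (-k * ‖X‖ ^ 2)) ?_ ?_ ?_ ?_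
    · refine Eventually.of_forall fun s => ?_
      have : Measurable (B.indicator (fun Z => Real.exp (-(s ^ 2)⁻¹ * φ Z) * w Z)) :=
        Measurable.indicator (by fun_prop) hBm
      exact (this.comp (measurable_const_smul s)).aestronglyMeasurable
    · filter_upwards [hpos] with s hs
      refine ae_of_all _ fun X => ?_
      by_cases hX : s • X ∈ B
      · rw [Set.indicator_of_mem hX, norm_mul, mul_comm, Real.norm_eq_abs (Real.exp _),
          Real.abs_exp]
        have h1 := hC _ hX
        refine mul_le_mul h1 (Real.exp_le_exp.2 ?_) (Real.exp_pos _).le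
          ((norm_nonneg _).trans h1)
        have h2 := hφk (s • X)
        rw [norm_smul, Real.norm_eq_abs, abs_of_pos hs, mul_pow] at h2
        have h3 := mul_le_mul_of_nonneg_left h2 (by positivity : 0 ≤ (s ^ 2)⁻¹)
        have h4 : (s ^ 2)⁻¹ * (k * (s ^ 2 * ‖X‖ ^ 2)) = k * ‖X‖ ^ 2 := by
          field_simp
        linarith
      · rw [Set.indicator_of_notMem hX, norm_zero]
        have : 0 ≤ C := (norm_nonneg _).trans (hC 0 (by simp))
        positivity
    · exact (integrable_rexp_neg_mul_sq_norm hk).const_mul C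
    · refine ae_of_all _ fun X => ?_
      have hsX : Tendsto (fun s : ℝ => s • X) (𝓝[>] 0) (𝓝 0) := by
        have : Tendsto (fun s : ℝ => s • X) (𝓝 0) (𝓝 ((0 : ℝ) • X)) :=
          (continuous_id.smul continuous_const).tendsto 0
        rw [zero_smul] at this
        exact this.mono_left nhdsWithin_le_nhds
      have hmem : ∀ᶠ s : ℝ in 𝓝[>] 0, s • X ∈ B :=
        hsX.eventually (Metric.closedBall_mem_nhds 0 one_pos)
      have hlim : Tendsto (fun s : ℝ => Real.exp (-(φ (s • X) / s ^ 2)) * w (s • X))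
          (𝓝[>] 0) (𝓝 (Real.exp (-Q X) * w 0)) :=
        ((Real.continuous_exp.tendsto _).comp (hQ X).neg).mul ((hw.tendsto 0).comp hsX)
      rw [mul_comm (w 0)]
      refine hlim.congr' ?_
      filter_upwards [hmem] with s hs
      rw [Set.indicator_of_mem hs]
      congr 2
      rw [div_eq_inv_mul, neg_mul]
  -- contribution of the complement
  have hout : Tendsto (fun s : ℝ => (s ^ Module.finrank ℝ E)⁻¹ *
        ∫ Z in Bᶜ, Real.exp (-(s ^ 2)⁻¹ * φ Z) * w Z) (𝓝[>] 0) (𝓝 0) := by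
    set J := ∫ Z in Bᶜ, Real.exp (-r₀ * φ Z) * w Z
    have hlim := (tendsto_inv_pow_mul_exp_neg_inv_sq hk (Module.finrank ℝ E)).mul_const
      (Real.exp (k * r₀) * J)
    rw [zero_mul] at hlim
    refine squeeze_zero' ?_ ?_ hlim
    · filter_upwards [hpos] with s hs
      exact mul_nonneg (by positivity)
        (integral_nonneg fun Z => mul_nonneg (Real.exp_pos _).le (hw0 Z))
    · filter_upwards [hpos, hlarge] with s hs hl
      rw [mul_assoc]
      refine mul_le_mul_of_nonneg_left ?_ (by positivity)
      rw [← mul_assoc, ← Real.exp_add, ← integral_const_mul]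
      refine setIntegral_mono_on
        (integrable_rexp_neg_mul_mul_of_le hφ hφ0 hl hint).integrableOn
        (hint.integrableOn.const_mul _) hBm.compl fun Z hZ => ?_
      rw [← mul_assoc, ← Real.exp_add]
      refine mul_le_mul_of_nonneg_right (Real.exp_le_exp.2 ?_) (hw0 Z)
      have hZ1 : 1 ≤ ‖Z‖ := by
        simp only [hB, Set.mem_compl_iff, Metric.mem_closedBall, dist_zero_right, not_le] at hZ
        exact hZ.le
      have h1 : k ≤ φ Z :=
        le_trans (le_mul_of_one_le_right hk.le (one_le_pow₀ hZ1)) (hφk Z)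
      nlinarith [mul_nonneg (sub_nonneg.2 hl) (sub_nonneg.2 h1)]
  have hsum := hin.add hout
  rw [add_zero] at hsum
  refine hsum.congr' ?_
  filter_upwards [hlarge] with s hl
  rw [← mul_add, integral_add_compl hBm (integrable_rexp_neg_mul_mul_of_le hφ hφ0 hl hint)]

end Laplace

section Bregman

variable {E : Type*} [NormedAddCommGroup E] [NormedSpace ℝ E]

/-- The Bregman divergence `h a - h (a + Z) - dh (a + Z) (a - (a + Z))`. -/
noncomputable def bregmanDiv (h : E → ℝ) (a Z : E) : ℝ :=
  fderiv ℝ h (a + Z) Z - h (a + Z) + h a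

variable {h : E → ℝ}

lemma hasDerivAt_bregmanDiv_smul (hh : ContDiff ℝ 2 h) (a X : E) (t : ℝ) :
    HasDerivAt (fun t : ℝ => bregmanDiv h a (t • X))
      (t * fderiv ℝ (fderiv ℝ h) (a + t • X) X X) t := by
  have hline : HasDerivAt (fun t : ℝ => a + t • X) X t := by
    simpa using ((hasDerivAt_id t).smul_const X).const_add a
  have hsmul : HasDerivAt (fun t : ℝ => t • X) X t := by
    simpa using (hasDerivAt_id t).smul_const X
  have h1 : HasDerivAt (fun t : ℝ => h (a + t • X)) (fderiv ℝ h (a + t • X) X) t :=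
    ((hh.differentiable (by norm_num)) _).hasFDerivAt.comp_hasDerivAt t hline
  have hd : Differentiable ℝ (fderiv ℝ h) :=
    (hh.fderiv_right (m := 1) (by norm_num)).differentiable (by norm_num)
  have h2 : HasDerivAt (fun t : ℝ => fderiv ℝ h (a + t • X))
      (fderiv ℝ (fderiv ℝ h) (a + t • X) X) t :=
    (hd _).hasFDerivAt.comp_hasDerivAt t hline
  have h3 := ((h2.clm_apply hsmul).sub h1).add_const (h a)
  refine h3.congr_deriv ?_
  simp

lemma continuous_bregmanDiv (hh : ContDiff ℝ 2 h) (a : E) : Continuous (bregmanDiv h a) := by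
  have h1 : Continuous (fderiv ℝ h) := hh.continuous_fderiv (by norm_num)
  have h2 := hh.continuous
  unfold bregmanDiv
  fun_prop

lemma continuous_fderiv_fderiv (hh : ContDiff ℝ 2 h) : Continuous (fderiv ℝ (fderiv ℝ h)) :=
  (hh.fderiv_right (m := 1) (by norm_num)).continuous_fderiv (by norm_num)

lemma mul_sq_norm_le_bregmanDiv (hh : ContDiff ℝ 2 h) {c : ℝ}
    (hc : ∀ Y v, c * ‖v‖ ^ 2 ≤ fderiv ℝ (fderiv ℝ h) Y v v) (a Z : E) :
    c / 2 * ‖Z‖ ^ 2 ≤ bregmanDiv h a Z := by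
  have hder : ∀ t : ℝ, HasDerivAt (fun t : ℝ => bregmanDiv h a (t • Z) - c / 2 * ‖Z‖ ^ 2 * t ^ 2)
      (t * fderiv ℝ (fderiv ℝ h) (a + t • Z) Z Z - c / 2 * ‖Z‖ ^ 2 * (2 * t)) t := fun t =>
    ((hasDerivAt_bregmanDiv_smul hh a Z t).sub
      ((hasDerivAt_pow 2 t).const_mul (c / 2 * ‖Z‖ ^ 2))).congr_deriv (by simp)
  have hmono := monotoneOn_of_deriv_nonneg (convex_Icc (0 : ℝ) 1)
    (fun t _ => (hder t).continuousAt.continuousWithinAt)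
    (fun t _ => (hder t).differentiableAt.differentiableWithinAt) (fun t ht => by
      rw [interior_Icc] at ht
      rw [(hder t).deriv]
      nlinarith [mul_nonneg ht.1.le (sub_nonneg.2 (hc (a + t • Z) Z))])
  have := hmono (Set.left_mem_Icc.2 zero_le_one) (Set.right_mem_Icc.2 zero_le_one) zero_le_one
  simpa [bregmanDiv] using this

lemma tendsto_bregmanDiv_smul_div_sq (hh : ContDiff ℝ 2 h) (a X : E) :
    Tendsto (fun t : ℝ => bregmanDiv h a (t • X) / t ^ 2) (𝓝[>] 0)
      (𝓝 (fderiv ℝ (fderiv ℝ h) a X X / 2)) := by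
  refine HasDerivAt.lhopital_zero_nhdsGT
    (Eventually.of_forall fun t => hasDerivAt_bregmanDiv_smul hh a X t)
    (Eventually.of_forall fun t => hasDerivAt_pow 2 t) ?_ ?_ ?_ ?_
  · filter_upwards [self_mem_nhdsWithin] with t ht
    have : (0 : ℝ) < t := ht
    simpa using this.ne'
  · have := (hasDerivAt_bregmanDiv_smul hh a X 0).continuousAt.tendsto
    simp only [bregmanDiv, zero_smul, add_zero, map_zero, zero_sub, neg_add_cancel] at this
    exact this.mono_left nhdsWithin_le_nhds
  · have : Tendsto (fun t : ℝ => t ^ 2) (𝓝 0) (𝓝 (0 ^ 2)) := (continuous_pow 2).tendsto 0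
    rw [zero_pow two_ne_zero] at this
    exact this.mono_left nhdsWithin_le_nhds
  · have hcont : Continuous (fun t : ℝ => fderiv ℝ (fderiv ℝ h) (a + t • X) X X / 2) := by
      have := continuous_fderiv_fderiv hh
      fun_prop
    have h1 := hcont.tendsto 0
    rw [zero_smul, add_zero] at h1
    refine (h1.mono_left nhdsWithin_le_nhds).congr' ?_
    filter_upwards [self_mem_nhdsWithin] with t ht
    have : (0 : ℝ) < t := ht
    have := this.ne'
    norm_num
    field_simp

end Bregman

/-- Semiclassical (`ℏ → 0⁺`) asymptotic unitarity of the KSH map in the abelian case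
`K = Tⁿ`: the integral
`I(ℏ) = (τ₂/(πℏ))^{n/2} ∫ e^{−(2τ₂/ℏ)(⟪Y+bm, ∇h(Y)⟫−h(Y))} √(det H(Y)) dY`
satisfies `I(ℏ) e^{−(2τ₂/ℏ)h(−bm)} → 1` as `ℏ → 0⁺` (and the integral is finite for all
`ℏ ∈ (0, ℏ₀]` once it is finite for `ℏ₀`). -/
theorem ksh_asymptotic_unitarity_semiclassical
    (n : ℕ) (h : EuclideanSpace ℝ (Fin n) → ℝ) (hsm : ContDiff ℝ (⊤ : ℕ∞) h)
    (H : EuclideanSpace ℝ (Fin n) → EuclideanSpace ℝ (Fin n) →L[ℝ] EuclideanSpace ℝ (Fin n))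
    (hH : ∀ Y v w : EuclideanSpace ℝ (Fin n), ⟪H Y v, w⟫ = fderiv ℝ (fderiv ℝ h) Y v w)
    (c : ℝ) (hc : 0 < c)
    (hbd : ∀ Y v : EuclideanSpace ℝ (Fin n), c * ‖v‖ ^ 2 ≤ ⟪H Y v, v⟫)
    (τ₂ : ℝ) (hτ₂ : 0 < τ₂) (b : ℝ) (hb : 0 < b) (m : EuclideanSpace ℝ (Fin n))
    (ℏ₀ : ℝ) (hℏ₀ : 0 < ℏ₀)
    (hint : Integrable (fun Y : EuclideanSpace ℝ (Fin n) =>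
      Real.exp (-(2 * τ₂ / ℏ₀) * (⟪Y + b • m, gradient h Y⟫ - h Y)) *
        Real.sqrt (LinearMap.det (H Y : EuclideanSpace ℝ (Fin n) →ₗ[ℝ] EuclideanSpace ℝ (Fin n))))) :
    (∀ ℏ : ℝ, ℏ ∈ Set.Ioc (0 : ℝ) ℏ₀ → Integrable (fun Y : EuclideanSpace ℝ (Fin n) =>
      Real.exp (-(2 * τ₂ / ℏ) * (⟪Y + b • m, gradient h Y⟫ - h Y)) *
        Real.sqrt (LinearMap.det (H Y : EuclideanSpace ℝ (Fin n) →ₗ[ℝ] EuclideanSpace ℝ (Fin n))))) ∧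
    Tendsto (fun ℏ : ℝ =>
        (τ₂ / (Real.pi * ℏ)) ^ ((n : ℝ) / 2) *
          (∫ Y : EuclideanSpace ℝ (Fin n),
            Real.exp (-(2 * τ₂ / ℏ) * (⟪Y + b • m, gradient h Y⟫ - h Y)) *
              Real.sqrt (LinearMap.det (H Y : EuclideanSpace ℝ (Fin n) →ₗ[ℝ] EuclideanSpace ℝ (Fin n)))) *
          Real.exp (-(2 * τ₂ / ℏ) * h (-(b • m))))
      (nhdsWithin 0 (Set.Ioi 0)) (nhds 1) := by
  have hh : ContDiff ℝ 2 h := contDiff_infty.1 hsm 2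
  set a : EuclideanSpace ℝ (Fin n) := -(b • m) with ha
  set φ : EuclideanSpace ℝ (Fin n) → ℝ := bregmanDiv h a with hφ
  set w : EuclideanSpace ℝ (Fin n) → ℝ := fun Z => √(LinearMap.det
    (H (a + Z) : EuclideanSpace ℝ (Fin n) →ₗ[ℝ] EuclideanSpace ℝ (Fin n))) with hw
  have hHcont : Continuous H := by
    refine continuous_clm_apply.2 fun v => ?_
    have h1 : (fun Y => H Y v) = fun Y => ∑ i, fderiv ℝ (fderiv ℝ h) Y v
        (EuclideanSpace.basisFun (Fin n) ℝ i) • EuclideanSpace.basisFun (Fin n) ℝ i := by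
      funext Y
      simp_rw [← hH, real_inner_comm]
      exact ((EuclideanSpace.basisFun (Fin n) ℝ).sum_repr' (H Y v)).symm
    rw [h1]
    have h2 := continuous_fderiv_fderiv hh
    fun_prop
  have hwc : Continuous w := by
    have h1 : Continuous fun Z => (H (a + Z)).det :=
      ContinuousLinearMap.continuous_det.comp (hHcont.comp (continuous_const.add continuous_id))
    exact Real.continuous_sqrt.comp h1
  have hφc : Continuous φ := continuous_bregmanDiv hh a
  have hφk : ∀ Z, c / 2 * ‖Z‖ ^ 2 ≤ φ Z :=
    mul_sq_norm_le_bregmanDiv hh (fun Y v => hH Y v v ▸ hbd Y v) a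
  have hphase : ∀ Z, ⟪a + Z + b • m, gradient h (a + Z)⟫ - h (a + Z) = φ Z - h a := by
    intro Z
    have h1 : a + Z + b • m = Z := by
      rw [ha]
      abel
    rw [h1, real_inner_comm, gradient, InnerProductSpace.toDual_symm_apply]
    simp only [hφ, bregmanDiv]
    ring
  have hfun : ∀ r : ℝ, (fun Z => Real.exp (-r * (⟪a + Z + b • m, gradient h (a + Z)⟫ - h (a + Z))) *
      w Z) = fun Z => Real.exp (r * h a) * (Real.exp (-r * φ Z) * w Z) := by
    intro r
    funext Z
    rw [hphase, ← mul_assoc, ← Real.exp_add]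
    congr 2
    ring
  have hiff : ∀ r : ℝ, Integrable (fun Y : EuclideanSpace ℝ (Fin n) =>
      Real.exp (-r * (⟪Y + b • m, gradient h Y⟫ - h Y)) * Real.sqrt (LinearMap.det
        (H Y : EuclideanSpace ℝ (Fin n) →ₗ[ℝ] EuclideanSpace ℝ (Fin n)))) ↔
      Integrable (fun Z => Real.exp (-r * φ Z) * w Z) := by
    intro r
    rw [← integrable_const_mul_iff (Real.exp_pos (r * h a)).ne'.isUnit
      (fun Z => Real.exp (-r * φ Z) * w Z), ← hfun]
    exact ((measurePreserving_add_left volume a).integrable_comp_emb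
      (measurableEmbedding_addLeft a)).symm
  have hintegral : ∀ r : ℝ, ∫ Y : EuclideanSpace ℝ (Fin n),
      Real.exp (-r * (⟪Y + b • m, gradient h Y⟫ - h Y)) * Real.sqrt (LinearMap.det
        (H Y : EuclideanSpace ℝ (Fin n) →ₗ[ℝ] EuclideanSpace ℝ (Fin n))) =
      Real.exp (r * h a) * ∫ Z, Real.exp (-r * φ Z) * w Z := by
    intro r
    rw [← integral_const_mul, ← hfun]
    exact ((measurePreserving_add_left volume a).integral_comp
      (measurableEmbedding_addLeft a) _).symm
  rw [hiff] at hint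
  refine ⟨fun ℏ hℏ => ?_, ?_⟩
  · rw [hiff]
    refine integrable_rexp_neg_mul_mul_of_le hφc (fun Z => le_trans (by positivity) (hφk Z)) ?_ hint
    exact div_le_div_of_nonneg_left (by positivity) hℏ.1 hℏ.2
  have hsymm : (H a : EuclideanSpace ℝ (Fin n) →ₗ[ℝ] EuclideanSpace ℝ (Fin n)).IsSymmetric := by
    intro v z
    have h1 : IsSymmSndFDerivAt ℝ h a := hh.contDiffAt.isSymmSndFDerivAt (by simp)
    change ⟪H a v, z⟫ = ⟪v, H a z⟫
    rw [real_inner_comm (H a z) v, hH, hH]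
    exact h1 v z
  obtain ⟨hdet, hgauss⟩ := integral_rexp_neg_half_inner_eq hsymm (fun v hv =>
    lt_of_lt_of_le (by have := norm_pos_iff.2 hv; positivity) (hbd a v))
  rw [finrank_euclideanSpace_fin] at hgauss
  have hlaplace := tendsto_laplace_integral hφc hwc (fun Z => Real.sqrt_nonneg _) (half_pos hc) hφk
    (tendsto_bregmanDiv_smul_div_sq hh a) hint
  have hval : w 0 * ∫ X, Real.exp (-(fderiv ℝ (fderiv ℝ h) a X X / 2)) =
      (2 * Real.pi) ^ ((n : ℝ) / 2) := by
    simp_rw [← hH]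
    simp only [ContinuousLinearMap.coe_coe] at hgauss
    rw [hgauss]
    simp only [hw, add_zero]
    have := (Real.sqrt_pos.2 hdet).ne'
    field_simp
  rw [hval, finrank_euclideanSpace_fin] at hlaplace
  have hscale : Tendsto (fun ℏ : ℝ => √(ℏ / (2 * τ₂))) (𝓝[>] 0) (𝓝[>] 0) := by
    refine tendsto_nhdsWithin_iff.2 ⟨?_, ?_⟩
    · have h1 : Continuous (fun ℏ : ℝ => √(ℏ / (2 * τ₂))) := by fun_prop
      have h2 := h1.tendsto 0
      rw [zero_div, Real.sqrt_zero] at h2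
      exact h2.mono_left nhdsWithin_le_nhds
    · filter_upwards [self_mem_nhdsWithin] with ℏ hℏ
      have : (0 : ℝ) < ℏ := hℏ
      exact Real.sqrt_pos.2 (by positivity)
  have hpi : (0 : ℝ) < (2 * Real.pi) ^ ((n : ℝ) / 2) := by positivity
  have hfinal := (hlaplace.comp hscale).const_mul (((2 * Real.pi) ^ ((n : ℝ) / 2))⁻¹)
  rw [inv_mul_cancel₀ hpi.ne'] at hfinal
  refine hfinal.congr' ?_
  filter_upwards [self_mem_nhdsWithin] with ℏ hℏ
  have hℏ' : (0 : ℝ) < ℏ := hℏ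
  have hsq : (√(ℏ / (2 * τ₂)) ^ 2)⁻¹ = 2 * τ₂ / ℏ := by
    rw [Real.sq_sqrt (by positivity), inv_div]
  have hpow : √(ℏ / (2 * τ₂)) ^ n = (ℏ / (2 * τ₂)) ^ ((n : ℝ) / 2) := by
    rw [Real.sqrt_eq_rpow, ← Real.rpow_natCast, ← Real.rpow_mul (by positivity)]
    congr 1
    ring
  have hpre : ((2 * Real.pi) ^ ((n : ℝ) / 2))⁻¹ * ((ℏ / (2 * τ₂)) ^ ((n : ℝ) / 2))⁻¹ =
      (τ₂ / (Real.pi * ℏ)) ^ ((n : ℝ) / 2) := by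
    rw [← mul_inv, ← Real.mul_rpow (by positivity) (by positivity),
      ← Real.inv_rpow (by positivity)]
    congr 1
    field_simp
  have hexp : Real.exp (2 * τ₂ / ℏ * h a) * Real.exp (-(2 * τ₂ / ℏ) * h a) = 1 := by
    rw [← Real.exp_add, neg_mul, add_neg_cancel, Real.exp_zero]
  rw [hintegral, ← hpre]
  simp only [Function.comp_apply, hsq, hpow]
  linear_combination (-(((2 * Real.pi) ^ ((n : ℝ) / 2))⁻¹ * ((ℏ / (2 * τ₂)) ^ ((n : ℝ) / 2))⁻¹ *
    ∫ Z, Real.exp (-(2 * τ₂ / ℏ) * φ Z) * w Z)) * hexp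
end

section
/- Let K = S¹ and let h : ℝ → ℝ be smooth with h''(y) ≥ c > 0 for all y ∈ ℝ. Fix ℏ > 0 and n ∈ ℤ, and define for τ₂ > 0 the quantity a_n(ℏ, τ₂) = √(τ₂/(πℏ)) ∫_ℝ e^{−(2τ₂/ℏ)·[(y + ℏn)·h'(y) − h(y)]} √(h''(y)) dy, assuming this integral is finite for some τ₂ = τ₀ > 0 (hence for all larger τ₂). Then there exists a constant b₁ = b₁(n, ℏ) ∈ ℝ such that, as τ₂ → ∞, a_n(ℏ, τ₂) = e^{(2τ₂/ℏ)·h(−ℏn)} · (1 + b₁·τ₂⁻¹ + O(τ₂⁻²)); that is, the function τ₂ ↦ a_n(ℏ, τ₂)·e^{−(2τ₂/ℏ)h(−ℏn)} − 1 − b₁·τ₂⁻¹ is O(τ₂⁻²) as τ₂ → ∞. -/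
open MeasureTheory Filter Asymptotics
open Set Topology

theorem hasDerivAt_integral_pow_mul_comp_mul {g : ℝ → ℝ} (hg : ContDiff ℝ 1 g) (k : ℕ) (t : ℝ) :
    HasDerivAt (fun t => ∫ s in (0 : ℝ)..1, s ^ k * g (s * t))
      (∫ s in (0 : ℝ)..1, s ^ (k + 1) * deriv g (s * t)) t := by
  have hg' : Continuous (deriv g) := hg.continuous_deriv le_rfl
  have hgc : Continuous g := hg.continuous
  obtain ⟨C, hC⟩ := ((isCompact_Icc (a := (0 : ℝ)) (b := 1)).prod
    (isCompact_closedBall t 1)).exists_bound_of_continuousOn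
    (f := fun p : ℝ × ℝ => p.1 ^ (k + 1) * deriv g (p.1 * p.2)) (by fun_prop)
  refine (intervalIntegral.hasDerivAt_integral_of_dominated_loc_of_deriv_le
    (F := fun t s => s ^ k * g (s * t)) (F' := fun t s => s ^ (k + 1) * deriv g (s * t))
    (bound := fun _ => C) (Metric.closedBall_mem_nhds t one_pos) ?_ ?_ ?_ ?_ ?_ ?_).2
  · exact .of_forall fun x => Continuous.aestronglyMeasurable (by fun_prop)
  · exact Continuous.intervalIntegrable (by fun_prop) _ _
  · exact Continuous.aestronglyMeasurable (by fun_prop)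
  · refine .of_forall fun s hs x hx => hC (s, x) ⟨?_, hx⟩
    rw [uIoc_of_le zero_le_one] at hs
    exact Ioc_subset_Icc_self hs
  · exact intervalIntegrable_const
  · refine .of_forall fun s _ x _ => ?_
    have h1 : HasDerivAt g (deriv g (s * x)) (s * x) :=
      (hg.differentiable one_ne_zero _).hasDerivAt
    have h2 : HasDerivAt (fun x => s * x) s x := by simpa using (hasDerivAt_id x).const_mul s
    exact ((h1.comp x h2).const_mul (s ^ k)).congr_deriv (by ring)

theorem contDiff_integral_pow_mul_comp_mul {g : ℝ → ℝ} (hg : ContDiff ℝ (⊤ : ℕ∞) g) (k : ℕ) :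
    ContDiff ℝ (⊤ : ℕ∞) (fun t => ∫ s in (0 : ℝ)..1, s ^ k * g (s * t)) := by
  rw [contDiff_infty]
  intro n
  induction n generalizing g k with
  | zero =>
    exact contDiff_zero.2 (continuous_iff_continuousAt.2 fun t =>
      (hasDerivAt_integral_pow_mul_comp_mul (hg.of_le (by exact_mod_cast le_top)) k t).continuousAt)
  | succ n ih =>
    have hd := hasDerivAt_integral_pow_mul_comp_mul (hg.of_le (by exact_mod_cast le_top)) k
    push_cast
    refine contDiff_succ_iff_deriv.2 ⟨fun t => (hd t).differentiableAt, by simp, ?_⟩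
    rw [funext fun t => (hd t).deriv]
    exact ih (contDiff_infty_iff_deriv.1 hg).2 (k + 1)

/-- Hadamard's lemma in one variable. -/
theorem exists_contDiff_eq_add_mul {f : ℝ → ℝ} (hf : ContDiff ℝ (⊤ : ℕ∞) f) :
    ∃ ψ : ℝ → ℝ, ContDiff ℝ (⊤ : ℕ∞) ψ ∧ ∀ t, f t = f 0 + t * ψ t := by
  have hf' := contDiff_infty_iff_deriv.1 hf
  refine ⟨_, contDiff_integral_pow_mul_comp_mul hf'.2 0, fun t => ?_⟩
  have h1 : ∫ s in (0 : ℝ)..t, deriv f s = f t - f 0 :=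
    intervalIntegral.integral_deriv_eq_sub (fun x _ => hf'.1 x)
      (hf'.2.continuous.intervalIntegrable _ _)
  have h2 := intervalIntegral.mul_integral_comp_mul_right (f := deriv f) (a := 0) (b := 1) t
  simp only [zero_mul, one_mul] at h2
  simp only [pow_zero, one_mul]
  rw [h2, h1]
  ring

theorem isBigO_sqrt_mul_exp_neg {m : ℝ} (hm : 0 < m) :
    (fun l : ℝ => √l * Real.exp (-m * l)) =O[atTop] fun l : ℝ => (l ^ 2)⁻¹ := by
  have h1 := (isBigO_refl (fun l : ℝ => √l) atTop).mul
    (isLittleO_exp_neg_mul_rpow_atTop hm (-(5 / 2))).isBigO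
  refine h1.trans_eventuallyEq ?_
  filter_upwards [eventually_gt_atTop 0] with l hl
  rw [Real.sqrt_eq_rpow, ← Real.rpow_add hl, ← Real.rpow_natCast l 2, ← Real.rpow_neg hl.le]
  norm_num

theorem integrable_exp_neg_mul_of_le_s12 {F g : ℝ → ℝ} (hF : Continuous F) (hg : Continuous g)
    (hF0 : ∀ t, 0 ≤ F t) {l₀ l : ℝ} (hl : l₀ ≤ l)
    (hi : Integrable fun t => Real.exp (-l₀ * F t) * g t) :
    Integrable fun t => Real.exp (-l * F t) * g t := by
  refine hi.mono (Continuous.aestronglyMeasurable (by fun_prop)) (.of_forall fun t => ?_)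
  simp only [norm_mul, Real.norm_eq_abs, Real.abs_exp]
  gcongr
  exact hF0 t

/-- Outside an interval on whose complement the phase is bounded below by a positive constant,
a Laplace integral is negligible. -/
theorem isBigO_laplace_tail {F g : ℝ → ℝ} (hF : Continuous F) (hg : Continuous g)
    (hF0 : ∀ t, 0 ≤ F t) {a b m : ℝ} (hab : a ≤ b) (hm : 0 < m) (hFm : ∀ t ∉ Ioc a b, m ≤ F t)
    {l₀ : ℝ} (hi : Integrable fun t => Real.exp (-l₀ * F t) * g t) :
    (fun l : ℝ => √l * ((∫ t, Real.exp (-l * F t) * g t) -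
      ∫ t in a..b, Real.exp (-l * F t) * g t)) =O[atTop] fun l : ℝ => (l ^ 2)⁻¹ := by
  refine IsBigO.trans (.of_bound
    (Real.exp (m * l₀) * ∫ t in (Ioc a b)ᶜ, ‖Real.exp (-l₀ * F t) * g t‖) ?_)
    (isBigO_sqrt_mul_exp_neg hm)
  filter_upwards [eventually_ge_atTop l₀] with l hl
  have hil := integrable_exp_neg_mul_of_le_s12 hF hg hF0 hl hi
  rw [intervalIntegral.integral_of_le hab,
    ← integral_add_compl (measurableSet_Ioc (a := a) (b := b)) hil, add_sub_cancel_left]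
  have key : ‖∫ t in (Ioc a b)ᶜ, Real.exp (-l * F t) * g t‖ ≤
      ∫ t in (Ioc a b)ᶜ, Real.exp (-m * (l - l₀)) * ‖Real.exp (-l₀ * F t) * g t‖ := by
    refine norm_integral_le_of_norm_le (hi.norm.integrableOn.const_mul _) ?_
    refine (ae_restrict_iff' measurableSet_Ioc.compl).2 (.of_forall fun t ht => ?_)
    simp only [norm_mul, Real.norm_eq_abs, Real.abs_exp]
    rw [← mul_assoc, ← Real.exp_add]
    gcongr
    nlinarith [hFm t ht]
  rw [integral_const_mul] at key
  rw [norm_mul, norm_mul, Real.norm_eq_abs (Real.exp _), Real.abs_exp]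
  calc _ ≤ ‖√l‖ * (Real.exp (-m * (l - l₀)) *
        ∫ t in (Ioc a b)ᶜ, ‖Real.exp (-l₀ * F t) * g t‖) := by gcongr
    _ = _ := by
      rw [show -m * (l - l₀) = m * l₀ + -m * l by ring, Real.exp_add]
      ring

/-- A Laplace integral over `[-1, 1]` with at least quadratic phase has order `l ^ (-1 / 2)`. -/
theorem isBigO_one_sqrt_mul_laplace {F φ : ℝ → ℝ} (hφ : Continuous φ)
    {c : ℝ} (hc : 0 < c) (hFc : ∀ t, c * t ^ 2 ≤ F t) :
    (fun l : ℝ => √l * ∫ t in (-1 : ℝ)..1, Real.exp (-l * F t) * φ t) =O[atTop]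
      fun _ => (1 : ℝ) := by
  obtain ⟨C, hC⟩ := (isCompact_Icc (a := (-1 : ℝ)) (b := 1)).exists_bound_of_continuousOn
    hφ.continuousOn
  have hC0 : 0 ≤ C := (norm_nonneg _).trans (hC 0 (by simp))
  refine .of_bound (C * √(Real.pi / c)) ?_
  filter_upwards [eventually_gt_atTop 0] with l hl
  have hgi : Integrable fun t : ℝ => Real.exp (-(l * c) * t ^ 2) :=
    integrable_exp_neg_mul_sq (mul_pos hl hc)
  have key : ‖∫ t in (-1 : ℝ)..1, Real.exp (-l * F t) * φ t‖ ≤ C * √(Real.pi / (l * c)) := by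
    rw [← integral_gaussian, ← integral_const_mul, intervalIntegral.integral_of_le (by norm_num)]
    calc _ ≤ ∫ t in Ioc (-1 : ℝ) 1, C * Real.exp (-(l * c) * t ^ 2) := by
          refine norm_integral_le_of_norm_le (hgi.integrableOn.const_mul _) ?_
          refine (ae_restrict_iff' measurableSet_Ioc).2 (.of_forall fun t ht => ?_)
          rw [norm_mul, Real.norm_eq_abs, Real.abs_exp, mul_comm C]
          exact mul_le_mul (Real.exp_le_exp.2 (by nlinarith [hFc t]))
            (hC t (Ioc_subset_Icc_self ht)) (norm_nonneg _) (Real.exp_pos _).le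
      _ ≤ _ := setIntegral_le_integral (hgi.const_mul _) (.of_forall fun t => by positivity)
  rw [norm_mul, Real.norm_of_nonneg (Real.sqrt_nonneg l), norm_one, mul_one]
  calc _ ≤ √l * (C * √(Real.pi / (l * c))) := by gcongr
    _ = _ := by
      rw [mul_left_comm, ← Real.sqrt_mul hl.le]
      congr 2
      field_simp

/-- Laplace integrals with phase `F`, `F' t = t * u t`: up to negligible terms, the integral of
`φ` is a multiple of a reference integral plus `l⁻¹` times another Laplace integral. -/
theorem exists_laplace_recursion {F u w φ : ℝ → ℝ} (hF : ∀ t, HasDerivAt F (t * u t) t)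
    (hu : ContDiff ℝ (⊤ : ℕ∞) u) (hu0 : ∀ t, u t ≠ 0) (hF1 : 0 < F 1) (hF2 : 0 < F (-1))
    (hw : ContDiff ℝ (⊤ : ℕ∞) w) (hw0 : w 0 ≠ 0) (hφ : ContDiff ℝ (⊤ : ℕ∞) φ) :
    ∃ φ₁ : ℝ → ℝ, ContDiff ℝ (⊤ : ℕ∞) φ₁ ∧
      (fun l : ℝ => √l * (∫ t in (-1 : ℝ)..1, Real.exp (-l * F t) * φ t) -
        φ 0 / w 0 * (√l * ∫ t in (-1 : ℝ)..1, Real.exp (-l * F t) * w t) -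
        l⁻¹ * (√l * ∫ t in (-1 : ℝ)..1, Real.exp (-l * F t) * φ₁ t))
        =O[atTop] fun l : ℝ => (l ^ 2)⁻¹ := by
  have hFc : Continuous F := continuous_iff_continuousAt.2 fun t => (hF t).continuousAt
  have hwc := hw.continuous
  have hφc := hφ.continuous
  obtain ⟨ψ, hψ, hψe⟩ := exists_contDiff_eq_add_mul 
    (hφ.sub ((contDiff_const (c := φ 0 / w 0)).mul hw))
  simp only [div_mul_cancel₀ _ hw0, sub_self, zero_add] at hψe
  set q : ℝ → ℝ := fun t => ψ t / u t with hq
  have hqs : ContDiff ℝ (⊤ : ℕ∞) q := hψ.div hu hu0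
  have hq' := contDiff_infty_iff_deriv.1 hqs
  have hq'c := hq'.2.continuous
  have hqc := hqs.continuous
  have huc := hu.continuous
  refine ⟨deriv q, hq'.2, ?_⟩
  have hB : (fun l : ℝ => -(l⁻¹ * (q 1 * (√l * Real.exp (-F 1 * l)) -
      q (-1) * (√l * Real.exp (-F (-1) * l))))) =O[atTop] fun l : ℝ => (l ^ 2)⁻¹ := by
    have h1 := ((isBigO_sqrt_mul_exp_neg hF1).const_mul_left (q 1)).sub
      ((isBigO_sqrt_mul_exp_neg hF2).const_mul_left (q (-1)))
    have h2 : (fun l : ℝ => l⁻¹) =O[atTop] fun _ => (1 : ℝ) :=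
      tendsto_inv_atTop_zero.isBigO_one ℝ
    simpa using (h2.mul h1).neg_left
  refine hB.congr' ?_ .rfl
  filter_upwards [eventually_gt_atTop 0] with l hl
  have hd : ∀ t, HasDerivAt (fun t => Real.exp (-l * F t) * q t)
      (-l * (Real.exp (-l * F t) * φ t - φ 0 / w 0 * (Real.exp (-l * F t) * w t)) +
        Real.exp (-l * F t) * deriv q t) t := fun t => by
    refine ((((hF t).const_mul (-l)).exp).mul (hq'.1 t).hasDerivAt).congr_deriv ?_
    have : t * u t * q t = φ t - φ 0 / w 0 * w t := by
      rw [hψe, hq]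
      field_simp [hu0 t]
    linear_combination (-l * Real.exp (-l * F t)) * this
  have hI : ∀ {f : ℝ → ℝ}, Continuous f → IntervalIntegrable f volume (-1) 1 :=
    fun hf => hf.intervalIntegrable _ _
  have hFTC := intervalIntegral.integral_eq_sub_of_hasDerivAt (a := -1) (b := 1)
    (fun t _ => hd t) (hI (by fun_prop))
  rw [intervalIntegral.integral_add (hI (by fun_prop)) (hI (by fun_prop)),
    intervalIntegral.integral_const_mul,
    intervalIntegral.integral_sub (hI (by fun_prop)) (hI (by fun_prop)),
    intervalIntegral.integral_const_mul] at hFTC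
  rw [show -F 1 * l = -l * F 1 by ring, show -F (-1) * l = -l * F (-1) by ring]
  have hl' : l⁻¹ * l = 1 := inv_mul_cancel₀ hl.ne'
  generalize (∫ t in (-1 : ℝ)..1, Real.exp (-l * F t) * φ t) = A at *
  generalize (∫ t in (-1 : ℝ)..1, Real.exp (-l * F t) * w t) = B at *
  linear_combination (l⁻¹ * √l) * hFTC + √l * (A - φ 0 / w 0 * B) * hl'

theorem isBigO_laplace_sqrt_phase {x x' : ℝ → ℝ} (hx : ∀ t, HasDerivAt x (x' t) t)
    (hx' : Continuous x') (h1 : 0 < x 1) (h2 : x (-1) < 0) :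
    (fun l : ℝ => √l * (∫ t in (-1 : ℝ)..1, Real.exp (-l * (x t ^ 2 / 2)) * x' t) -
      √(2 * Real.pi)) =O[atTop] fun l : ℝ => (l ^ 2)⁻¹ := by
  have hgi : Integrable fun t : ℝ => Real.exp (-1 * (t ^ 2 / 2)) * 1 := by
    convert integrable_exp_neg_mul_sq (b := 1 / 2) (by norm_num) using 3
    ring_nf
  have hT := isBigO_laplace_tail (F := fun t => t ^ 2 / 2) (g := fun _ => 1) (a := x (-1))
    (b := x 1) (m := min (x (-1) ^ 2 / 2) (x 1 ^ 2 / 2)) (by fun_prop) (by fun_prop)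
    (fun t => by positivity) (by linarith) (by have := h2.ne; positivity) (fun t ht => ?_) hgi
  · refine hT.neg_left.congr' ?_ .rfl
    filter_upwards [eventually_gt_atTop 0] with l hl
    have hc := intervalIntegral.integral_comp_mul_deriv (a := -1) (b := 1)
      (g := fun s => Real.exp (-l * (s ^ 2 / 2))) (fun t _ => hx t) hx'.continuousOn (by fun_prop)
    simp only [Function.comp_def] at hc
    have hG : √l * ∫ t : ℝ, Real.exp (-l * (t ^ 2 / 2)) = √(2 * Real.pi) := by
      have := integral_gaussian (l / 2)
      rw [show (fun t : ℝ => Real.exp (-l * (t ^ 2 / 2))) = fun t => Real.exp (-(l / 2) * t ^ 2) by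
        ext t; ring_nf, this, ← Real.sqrt_mul hl.le]
      congr 1
      field_simp
    simp only [mul_one]
    rw [hc, mul_sub, hG]
    ring
  · rw [mem_Ioc, not_and_or, not_lt, not_le] at ht
    rcases ht with ht | ht
    · exact (min_le_left _ _).trans (by nlinarith)
    · exact (min_le_right _ _).trans (by nlinarith)

theorem eq_sq_mul_integral_of_hasDerivAt {F u : ℝ → ℝ} (hF : ∀ t, HasDerivAt F (t * u t) t)
    (hF0 : F 0 = 0) (hu : Continuous u) (t : ℝ) :
    F t = t ^ 2 * ∫ s in (0 : ℝ)..1, s ^ 1 * u (s * t) := by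
  have h1 := intervalIntegral.integral_eq_sub_of_hasDerivAt (a := 0) (b := t) (fun s _ => hF s)
    ((continuous_id.mul hu).intervalIntegrable _ _)
  have h2 := intervalIntegral.mul_integral_comp_mul_right (f := fun s => s * u s)
    (a := 0) (b := 1) t
  simp only [zero_mul, one_mul] at h2
  rw [hF0, sub_zero, ← h2, ← intervalIntegral.integral_const_mul] at h1
  rw [← h1, ← intervalIntegral.integral_const_mul]
  congr 1
  ext s
  ring

theorem half_le_integral_mul_comp_mul {u : ℝ → ℝ} (hu : Continuous u) {c : ℝ}
    (huc : ∀ t, c ≤ u t) (t : ℝ) : c / 2 ≤ ∫ s in (0 : ℝ)..1, s ^ 1 * u (s * t) := by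
  have h1 : ∫ s in (0 : ℝ)..1, s ^ 1 * c = c / 2 := by
    rw [intervalIntegral.integral_mul_const, integral_pow]
    norm_num
    ring
  rw [← h1]
  refine intervalIntegral.integral_mono_on zero_le_one
    (Continuous.intervalIntegrable (by fun_prop) _ _)
    (Continuous.intervalIntegrable (by fun_prop) _ _) fun s hs => ?_
  exact mul_le_mul_of_nonneg_left (huc _) (pow_nonneg hs.1 1)

theorem half_mul_sq_le_of_hasDerivAt {F u : ℝ → ℝ} (hF : ∀ t, HasDerivAt F (t * u t) t)
    (hF0 : F 0 = 0) (hu : Continuous u) {c : ℝ} (huc : ∀ t, c ≤ u t) (t : ℝ) :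
    c / 2 * t ^ 2 ≤ F t := by
  rw [eq_sq_mul_integral_of_hasDerivAt hF hF0 hu, mul_comm]
  exact mul_le_mul_of_nonneg_left (half_le_integral_mul_comp_mul hu huc t) (sq_nonneg t)

/-- Second-order Laplace asymptotics for the phase `F` with `F 0 = 0`, `F' t = t * u t`, and the
amplitude `√u`. -/
theorem exists_laplace_second_order {F u : ℝ → ℝ} (hF : ∀ t, HasDerivAt F (t * u t) t)
    (hF0 : F 0 = 0) (hu : ContDiff ℝ (⊤ : ℕ∞) u) {c : ℝ} (hc : 0 < c) (huc : ∀ t, c ≤ u t)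
    {l₀ : ℝ} (hi : Integrable fun t => Real.exp (-l₀ * F t) * √(u t)) :
    ∃ b : ℝ, (fun l : ℝ => √l * (∫ t, Real.exp (-l * F t) * √(u t)) - √(2 * Real.pi) - b / l)
      =O[atTop] fun l : ℝ => (l ^ 2)⁻¹ := by
  have hFcont : Continuous F := continuous_iff_continuousAt.2 fun t => (hF t).continuousAt
  have hupos : ∀ t, 0 < u t := fun t => hc.trans_le (huc t)
  have hFc := half_mul_sq_le_of_hasDerivAt hF hF0 hu.continuous huc
  have hF0' : ∀ t, 0 ≤ F t := fun t => le_trans (by positivity) (hFc t)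
  have hg : ContDiff ℝ (⊤ : ℕ∞) fun t => √(u t) := hu.sqrt fun t => (hupos t).ne'
  set P : ℝ → ℝ := fun t => ∫ s in (0 : ℝ)..1, s ^ 1 * u (s * t) with hP
  have hPs : ContDiff ℝ (⊤ : ℕ∞) P := contDiff_integral_pow_mul_comp_mul hu 1
  have hFP : ∀ t, F t = t ^ 2 * P t := eq_sq_mul_integral_of_hasDerivAt hF hF0 hu.continuous
  have hP0 : P 0 = u 0 / 2 := by
    simp [hP]
    ring
  have hPpos : ∀ t, 0 < P t := fun t =>
    (half_pos hc).trans_le (half_le_integral_mul_comp_mul hu.continuous huc t)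
  have hsq : ContDiff ℝ (⊤ : ℕ∞) fun t => √(2 * P t) :=
    (contDiff_const.mul hPs).sqrt fun t => (mul_pos two_pos (hPpos t)).ne'
  set x : ℝ → ℝ := fun t => t * √(2 * P t) with hx
  have hxs : ContDiff ℝ (⊤ : ℕ∞) x := contDiff_id.mul hsq
  have hx' := contDiff_infty_iff_deriv.1 hxs
  have hxF : ∀ t, x t ^ 2 / 2 = F t := fun t => by
    simp only [hx]
    rw [mul_pow, Real.sq_sqrt (by linarith [hPpos t]), hFP]
    ring
  have hx'0 : deriv x 0 = √(u 0) := by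
    have := ((hasDerivAt_id (0 : ℝ)).mul (hsq.differentiable (by simp) 0).hasDerivAt).deriv
    simp only [id, one_mul, zero_mul, add_zero, hP0] at this
    rw [← mul_div_cancel₀ (u 0) (two_ne_zero (α := ℝ)), ← this]
    rfl
  have hw0 : deriv x 0 ≠ 0 := hx'0 ▸ (Real.sqrt_pos.2 (hupos 0)).ne'
  have hC := isBigO_laplace_sqrt_phase (fun t => (hx'.1 t).hasDerivAt) hx'.2.continuous
    (by simp only [hx]; have := hPpos 1; positivity)
    (by simp only [hx]; have := Real.sqrt_pos.2 (mul_pos two_pos (hPpos (-1))); linarith)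
  simp only [hxF] at hC
  have hF1 : 0 < F 1 := lt_of_lt_of_le (by linarith) (hFc 1)
  have hF2 : 0 < F (-1) := lt_of_lt_of_le (by linarith) (hFc (-1))
  have hu0 := fun t => (hupos t).ne'
  obtain ⟨φ₁, hφ₁, h₁⟩ := exists_laplace_recursion hF hu hu0 hF1 hF2 hx'.2 hw0 hg
  obtain ⟨φ₂, hφ₂, h₂⟩ := exists_laplace_recursion hF hu hu0 hF1 hF2 hx'.2 hw0 hφ₁
  have hA := isBigO_one_sqrt_mul_laplace hφ₂.continuous (half_pos hc) hFc
  have hT := isBigO_laplace_tail hFcont hg.continuous hF0' (a := -1) (b := 1) (by norm_num)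
    (half_pos hc) (fun t ht => ?_) hi
  · rw [hx'0, div_self (Real.sqrt_pos.2 (hupos 0)).ne'] at h₁
    have hinv : (fun l : ℝ => l⁻¹) =O[atTop] fun _ => (1 : ℝ) :=
      tendsto_inv_atTop_zero.isBigO_one ℝ
    have hA' := ((isBigO_refl (fun l : ℝ => (l ^ 2)⁻¹) atTop).mul hA)
    have h₂' := hinv.mul h₂
    have hC' := hinv.mul (hC.const_mul_left (φ₁ 0 / deriv x 0))
    simp only [mul_one] at hA'
    simp only [one_mul] at h₂' hC'
    refine ⟨φ₁ 0 / deriv x 0 * √(2 * Real.pi),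
      (((((hT.add h₁).add hC).add h₂').add hC').add hA').congr_left fun l => ?_⟩
    ring
  · rw [mem_Ioc, not_and_or, not_lt, not_le] at ht
    refine le_trans ?_ (hFc t)
    have : 1 ≤ t ^ 2 := by rcases ht with ht | ht <;> nlinarith
    nlinarith

/-- For `K = S¹`: second-order large-`τ₂` asymptotics of the norms
`a_n(ℏ,τ₂) = √(τ₂/(πℏ)) ∫ e^{−(2τ₂/ℏ)[(y+ℏn)h'(y)−h(y)]} √(h''(y)) dy`. There is a
constant `b₁ = b₁(n,ℏ)` with
`a_n(ℏ,τ₂) = e^{(2τ₂/ℏ)h(−ℏn)} (1 + b₁ τ₂⁻¹ + O(τ₂⁻²))` as `τ₂ → ∞`. -/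
theorem circle_norm_second_order_asymptotics
    (h : ℝ → ℝ) (hsm : ContDiff ℝ (⊤ : ℕ∞) h)
    (c : ℝ) (hc : 0 < c) (hbd : ∀ y : ℝ, c ≤ deriv (deriv h) y)
    (ℏ : ℝ) (hℏ : 0 < ℏ) (n : ℤ)
    (τ₀ : ℝ) (hτ₀ : 0 < τ₀)
    (hint : Integrable (fun y : ℝ =>
      Real.exp (-(2 * τ₀ / ℏ) * ((y + ℏ * n) * deriv h y - h y)) *
        Real.sqrt (deriv (deriv h) y))) :
    (∀ τ₂ : ℝ, τ₀ ≤ τ₂ → Integrable (fun y : ℝ =>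
      Real.exp (-(2 * τ₂ / ℏ) * ((y + ℏ * n) * deriv h y - h y)) *
        Real.sqrt (deriv (deriv h) y))) ∧
    ∃ b₁ : ℝ,
      (fun τ₂ : ℝ =>
          Real.sqrt (τ₂ / (Real.pi * ℏ)) *
            (∫ y : ℝ, Real.exp (-(2 * τ₂ / ℏ) * ((y + ℏ * n) * deriv h y - h y)) *
              Real.sqrt (deriv (deriv h) y)) *
            Real.exp (-(2 * τ₂ / ℏ) * h (-(ℏ * n))) - 1 - b₁ / τ₂)
        =O[atTop] fun τ₂ : ℝ => (τ₂ ^ 2)⁻¹ := by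
  set y₀ : ℝ := -(ℏ * n) with hy₀
  set F : ℝ → ℝ := fun t => t * deriv h (t + y₀) - h (t + y₀) + h y₀ with hFdef
  set u : ℝ → ℝ := fun t => deriv (deriv h) (t + y₀) with hudef
  have hh := contDiff_infty_iff_deriv.1 hsm
  have hh' := contDiff_infty_iff_deriv.1 hh.2
  have hu : ContDiff ℝ (⊤ : ℕ∞) u := hh'.2.comp (contDiff_id.add contDiff_const)
  have hF : ∀ t, HasDerivAt F (t * u t) t := fun t => by
    have h1 : HasDerivAt (fun t => deriv h (t + y₀)) (u t) t :=
      (hh'.1 (t + y₀)).hasDerivAt.comp_add_const t y₀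
    have h2 : HasDerivAt (fun t => h (t + y₀)) (deriv h (t + y₀)) t :=
      (hh.1 (t + y₀)).hasDerivAt.comp_add_const t y₀
    refine ((((hasDerivAt_id t).mul h1).sub h2).add_const (h y₀)).congr_deriv ?_
    simp
  have hF0 : F 0 = 0 := by simp [hFdef]
  have hFcont : Continuous F := continuous_iff_continuousAt.2 fun t => (hF t).continuousAt
  have hF_nonneg : ∀ t, 0 ≤ F t := fun t =>
    le_trans (by positivity)
      (half_mul_sq_le_of_hasDerivAt hF hF0 hu.continuous (fun t => hbd (t + y₀)) t)
  have key : ∀ l : ℝ, (fun y : ℝ => Real.exp (-l * ((y + ℏ * n) * deriv h y - h y)) *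
      √(deriv (deriv h) y)) = fun y => Real.exp (l * h y₀) *
        (Real.exp (-l * F (y - y₀)) * √(u (y - y₀))) := fun l => by
    ext y
    rw [← mul_assoc, ← Real.exp_add]
    simp only [hFdef, hudef, sub_add_cancel]
    congr 2
    rw [hy₀]
    ring
  have hi : Integrable fun t => Real.exp (-(2 * τ₀ / ℏ) * F t) * √(u t) := by
    rw [key] at hint
    have := (hint.const_mul (Real.exp (2 * τ₀ / ℏ * h y₀))⁻¹).comp_add_right y₀
    simpa only [inv_mul_cancel_left₀ (Real.exp_ne_zero _), add_sub_cancel_right] using this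
  constructor
  · intro τ₂ hτ
    rw [key]
    refine Integrable.const_mul (Integrable.comp_sub_right
      (f := fun t => Real.exp (-(2 * τ₂ / ℏ) * F t) * √(u t)) ?_ y₀) _
    exact integrable_exp_neg_mul_of_le_s12 hFcont hu.continuous.sqrt hF_nonneg (by gcongr) hi
  · obtain ⟨b, hb⟩ := exists_laplace_second_order hF hF0 hu hc (fun t => hbd (t + y₀)) hi
    have hl : Tendsto (fun τ : ℝ => 2 * τ / ℏ) atTop atTop :=
      (tendsto_id.const_mul_atTop two_pos).atTop_div_const hℏ
    have hpi : √(2 * Real.pi) ≠ 0 := by positivity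
    refine ⟨b * ℏ / (2 * √(2 * Real.pi)), ?_⟩
    have hb' := (hb.comp_tendsto hl).const_mul_left (√(2 * Real.pi))⁻¹
    refine (hb'.congr' ?_ .rfl).trans (.of_bound (ℏ ^ 2 / 4) ?_)
    · filter_upwards [eventually_gt_atTop 0] with τ hτ
      simp only [Function.comp_def]
      rw [key, integral_const_mul,
        integral_sub_right_eq_self (fun t => Real.exp (-(2 * τ / ℏ) * F t) * √(u t)) y₀,
        show τ / (Real.pi * ℏ) = (2 * τ / ℏ) / (2 * Real.pi) by field_simp,
        Real.sqrt_div (by positivity) (2 * Real.pi), neg_mul, Real.exp_neg]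
      have hE := Real.exp_ne_zero (2 * τ / ℏ * h y₀)
      generalize √(2 * τ / ℏ) = r
      field_simp
    · refine .of_forall fun τ => le_of_eq ?_
      simp only [Function.comp_def, norm_inv, norm_pow, norm_div, norm_mul, Real.norm_eq_abs,
        sq_abs, div_pow, mul_pow, abs_of_pos hℏ]
      norm_num
      field_simp
end
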